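/- arXiv:1008.1830 — 7 statements merged into one kernel-verified Lean document; each statement's English description precedes it below -/
import Mathlib

section
/- For all real numbers β, δ and every complex number z with Re z > −β + |δ|, the double series defining the q-zeta function ζ_{β,δ}(z) converges absolutely, i.e. Σ_{n=0}^∞ Σ_{j=0}^{2n+1} |q^{β(n+1/2) + δ(j−n−1/2)} [n+1]_q^{−z}| < ∞. -/
open Complex Real Filter Finset Topology

/-- The q-number `[x]_q = (q^x - q^{-x})/(q - q⁻¹)`. -/
noncomputable def qnum (q x : ℝ) : ℝ := (q ^ x - q ^ (-x)) / (q - q⁻¹)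

/-- For a positive real `a` and `w : ℂ`, `a^w := exp(w · ln a)`. -/
noncomputable def rcpow (a : ℝ) (w : ℂ) : ℂ := Complex.exp (w * (Real.log a : ℂ))

/-- The `(n,j)`-term of the q-zeta double series, corresponding to
`l = n + 1/2` and `k = j - n - 1/2`: `q^{βl+δk} · [l+1/2]_q^{-z}`. -/
noncomputable def qzetaTerm (q β δ : ℝ) (z : ℂ) (n j : ℕ) : ℂ :=
  ((q ^ (β * ((n : ℝ) + 1/2) + δ * ((j : ℝ) - (n : ℝ) - 1/2)) : ℝ) : ℂ) *
    rcpow (qnum q ((n : ℝ) + 1)) (-z)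

/-- The q-number `[n+1]_q` is `q^{-n}` up to a factor between `1` and `(1 - q²)⁻¹`. -/
lemma qnum_succ_eq {q : ℝ} (hq0 : 0 < q) (hq1 : q < 1) (n : ℕ) :
    qnum q ((n : ℝ) + 1) = (q ^ n)⁻¹ * ((1 - (q ^ 2) ^ (n + 1)) / (1 - q ^ 2)) := by
  have h2 : 1 - q ^ 2 ≠ 0 := by nlinarith
  have h3 : q ^ 2 - 1 ≠ 0 := by nlinarith
  have hcast : (n : ℝ) + 1 = ((n + 1 : ℕ) : ℝ) := by push_cast; ring
  have hq : q - q⁻¹ = -(1 - q ^ 2) / q := by field_simp; ring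
  have hn : q ^ n ≠ 0 := by positivity
  rw [qnum, Real.rpow_neg hq0.le, hcast, Real.rpow_natCast, hq, ← pow_mul, mul_comm 2, pow_mul,
    pow_succ q n]
  field_simp
  ring

lemma abs_log_qnum_succ_add_le {q : ℝ} (hq0 : 0 < q) (hq1 : q < 1) (n : ℕ) :
    |Real.log (qnum q ((n : ℝ) + 1)) + n * Real.log q| ≤ -Real.log (1 - q ^ 2) := by
  have h2 : 0 < 1 - q ^ 2 := by nlinarith
  have hpow : (q ^ 2) ^ (n + 1) ≤ q ^ 2 := pow_le_of_le_one (by positivity) (by nlinarith) (by simp)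
  have hpos : 0 < (q ^ 2) ^ (n + 1) := by positivity
  have hnum : 0 < 1 - (q ^ 2) ^ (n + 1) := by linarith
  rw [qnum_succ_eq hq0 hq1, Real.log_mul (by positivity) (by positivity), Real.log_inv,
    Real.log_pow, Real.log_div hnum.ne' h2.ne', abs_le]
  have hle : Real.log (1 - q ^ 2) ≤ Real.log (1 - (q ^ 2) ^ (n + 1)) :=
    Real.log_le_log h2 (by linarith)
  have hle0 : Real.log (1 - (q ^ 2) ^ (n + 1)) ≤ 0 := Real.log_nonpos hnum.le (by linarith)
  constructor <;> linarith

lemma norm_rcpow (a : ℝ) (w : ℂ) : ‖rcpow a w‖ = Real.exp (w.re * Real.log a) := by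
  simp [rcpow, Complex.norm_exp]

lemma norm_qzetaTerm_le {q : ℝ} (hq0 : 0 < q) (hq1 : q < 1) (β δ : ℝ) (z : ℂ) {n j : ℕ}
    (hj : j < 2 * n + 2) :
    ‖qzetaTerm q β δ z n j‖ ≤
      Real.exp ((β - |δ|) / 2 * Real.log q + |z.re| * -Real.log (1 - q ^ 2)) *
        Real.exp ((β - |δ| + z.re) * Real.log q) ^ n := by
  have hL : Real.log q < 0 := Real.log_neg hq0 hq1
  have hk : |(j : ℝ) - n - 1 / 2| ≤ n + 1 / 2 := by
    have hj' : (j : ℝ) ≤ 2 * n + 1 := by exact_mod_cast Nat.lt_succ_iff.mp hj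
    have hj0 : (0 : ℝ) ≤ j := j.cast_nonneg
    rw [abs_le]
    constructor <;> linarith
  have hδ : -(|δ| * (n + 1 / 2)) ≤ δ * ((j : ℝ) - n - 1 / 2) := by
    have h := neg_abs_le (δ * ((j : ℝ) - n - 1 / 2))
    rw [abs_mul] at h
    have := mul_le_mul_of_nonneg_left hk (abs_nonneg δ)
    linarith
  have hlog : -(z.re * (Real.log (qnum q ((n : ℝ) + 1)) + n * Real.log q)) ≤
      |z.re| * -Real.log (1 - q ^ 2) := by
    refine (neg_le_abs _).trans ?_
    rw [abs_mul]
    exact mul_le_mul_of_nonneg_left (abs_log_qnum_succ_add_le hq0 hq1 n) (abs_nonneg _)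
  rw [qzetaTerm, norm_mul, norm_rcpow, Complex.norm_real, Real.norm_eq_abs,
    abs_of_pos (Real.rpow_pos_of_pos hq0 _), Real.rpow_def_of_pos hq0, ← Real.exp_nat_mul,
    ← Real.exp_add, ← Real.exp_add, Real.exp_le_exp, Complex.neg_re]
  have := mul_le_mul_of_nonpos_right hδ hL.le
  linarith

theorem statement0 (q : ℝ) (hq0 : 0 < q) (hq1 : q < 1) (β δ : ℝ) (z : ℂ)
    (hz : -β + |δ| < z.re) :
    Summable (fun n : ℕ => ∑ j ∈ Finset.range (2 * n + 2), ‖qzetaTerm q β δ z n j‖) := by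
  set C := Real.exp ((β - |δ|) / 2 * Real.log q + |z.re| * -Real.log (1 - q ^ 2))
  set r := Real.exp ((β - |δ| + z.re) * Real.log q) with hr
  have hr1 : ‖r‖ < 1 := by
    rw [Real.norm_eq_abs, hr, Real.abs_exp, Real.exp_lt_one_iff]
    exact mul_neg_of_pos_of_neg (by linarith) (Real.log_neg hq0 hq1)
  have hsum : Summable fun n : ℕ => 2 * C * ((n : ℝ) ^ 1 * r ^ n) + 2 * C * r ^ n :=
    ((summable_pow_mul_geometric_of_norm_lt_one 1 hr1).mul_left _).add
      ((summable_geometric_of_norm_lt_one hr1).mul_left _)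
  refine Summable.of_nonneg_of_le (fun n => Finset.sum_nonneg fun j _ => norm_nonneg _)
    (fun n => ?_) hsum
  refine (Finset.sum_le_card_nsmul _ _ (C * r ^ n) fun j hj =>
    norm_qzetaTerm_le hq0 hq1 β δ z (Finset.mem_range.mp hj)).trans_eq ?_
  rw [Finset.card_range, nsmul_eq_mul]
  push_cast
  ring
end

section
/- For all real numbers β, δ and every complex number z with Re z > −β + |δ|, the series defining F_{β,δ}(z) converges absolutely and ζ_{β,δ}(z) = F_{β,δ}(z), i.e. ζ_{β,δ}(z) = q^{β/2}(q^{−δ/2}+q^{δ/2})(1−q²)^z · Σ_{j=0}^∞ C(z+j−1, j) q^{2j} / ((1−q^{β−δ+2j+z})(1−q^{β+δ+2j+z})). -/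
open Complex Real Filter Finset Topology

/-- The q-zeta function `ζ_{β,δ}(z)` as a double series. -/
noncomputable def qzeta (q β δ : ℝ) (z : ℂ) : ℂ :=
  ∑' n : ℕ, ∑ j ∈ Finset.range (2 * n + 2), qzetaTerm q β δ z n j

/-- The generalized binomial coefficient `C(z+j-1, j) = (1/j!)·∏_{i=0}^{j-1}(z+i)`. -/
noncomputable def binomC (z : ℂ) (j : ℕ) : ℂ :=
  (∏ i ∈ Finset.range j, (z + (i : ℂ))) / (Nat.factorial j : ℂ)

/-- The `j`-th term of the series defining `F_{β,δ}(z)`. -/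
noncomputable def Fterm (q β δ : ℝ) (z : ℂ) (j : ℕ) : ℂ :=
  binomC z j * (q : ℂ) ^ (2 * j) /
    ((1 - rcpow q (((β - δ + 2 * (j : ℝ)) : ℝ) + z)) *
     (1 - rcpow q (((β + δ + 2 * (j : ℝ)) : ℝ) + z)))

theorem binomC_eq_choose (z : ℂ) (j : ℕ) : binomC z j = Ring.choose (z + j - 1) j := by
  have hasc : (ascPochhammer ℂ j).eval z = ∏ i ∈ Finset.range j, (z + (i : ℂ)) := by
    induction j with
    | zero => simp
    | succ j ih => rw [ascPochhammer_succ_eval, ih, Finset.prod_range_succ]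
  rw [binomC, ← hasc, Ring.choose_eq_smul, Polynomial.descPochhammer_smeval_eq_ascPochhammer,
    Polynomial.ascPochhammer_smeval_eq_eval, show z + j - 1 - j + 1 = z by ring, div_eq_inv_mul]
  simp

/-- The binomial series `(1 - x)^{-z} = ∑ C(z+j-1, j) x^j` for `0 ≤ x < 1`. -/
theorem hasSum_binomC_mul_pow (z : ℂ) {x : ℝ} (hx0 : 0 ≤ x) (hx1 : x < 1) :
    HasSum (fun j : ℕ => binomC z j * (x : ℂ) ^ j) (rcpow (1 - x) (-z)) := by
  have hmem : (x : ℂ) ∈ Metric.eball (0 : ℂ) 1 := by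
    rw [← ENNReal.ofReal_one, Metric.eball_ofReal]
    simpa [abs_of_nonneg hx0] using hx1
  have h := (Complex.one_div_one_sub_cpow_hasFPowerSeriesOnBall_zero z).hasSum hmem
  have hpow : rcpow (1 - x) (-z) = 1 / (1 - (0 + (x : ℂ))) ^ z := by
    have hne : (1 - (x : ℂ)) ≠ 0 := by
      exact_mod_cast (sub_pos.2 hx1).ne'
    rw [zero_add, one_div, ← Complex.cpow_neg, Complex.cpow_def_of_ne_zero hne, rcpow,
      Complex.ofReal_log (sub_pos.2 hx1).le]
    push_cast
    ring_nf
  rw [hpow]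
  refine h.congr_fun fun j => ?_
  simp [binomC_eq_choose, mul_comm]

/-- Exchange of summation for a power series weighted by the complete homogeneous polynomials
of two numbers in the open unit disc. -/
theorem summable_and_tsum_mul_sum_pow {w : ℕ → ℂ} (hw : Summable fun j => ‖w j‖) {Q a b : ℂ}
    (hQ : ‖Q‖ ≤ 1) (ha : ‖a‖ < 1) (hb : ‖b‖ < 1) :
    Summable (fun j => w j / ((1 - Q ^ j * a) * (1 - Q ^ j * b))) ∧
    ∑' n, (∑' j, w j * (Q ^ n) ^ j) * ∑ k ∈ range (n + 1), b ^ k * a ^ (n - k) =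
      ∑' j, w j / ((1 - Q ^ j * a) * (1 - Q ^ j * b)) := by
  have hgeom : ∀ {c : ℂ}, ‖c‖ < 1 → Summable fun k : ℕ => ‖c ^ k‖ := fun hc => by
    simpa using summable_geometric_of_lt_one (norm_nonneg _) hc
  have hmul : ∀ {c : ℂ} (j : ℕ), ‖c‖ < 1 → ‖Q ^ j * c‖ < 1 := fun {c} j hc => by
    rw [norm_mul, norm_pow]
    exact (mul_le_of_le_one_left (norm_nonneg _) (pow_le_one₀ (norm_nonneg _) hQ)).trans_lt hc
  set h : ℕ → ℂ := fun n => ∑ k ∈ range (n + 1), b ^ k * a ^ (n - k) with hh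
  have hsum : Summable fun p : ℕ × ℕ => w p.1 * (Q ^ p.2) ^ p.1 * h p.2 := by
    refine Summable.of_norm_bounded (hw.mul_of_nonneg
      (summable_norm_sum_mul_range_of_summable_norm (hgeom hb) (hgeom ha))
      (fun _ => norm_nonneg _) fun _ => norm_nonneg _) fun p => ?_
    rw [norm_mul, norm_mul, norm_pow, norm_pow]
    refine mul_le_mul_of_nonneg_right (mul_le_of_le_one_right (norm_nonneg _) ?_) (norm_nonneg _)
    exact pow_le_one₀ (by positivity) (pow_le_one₀ (norm_nonneg _) hQ)
  have hinner : ∀ j, HasSum (fun n => w j * (Q ^ n) ^ j * h n)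
      (w j / ((1 - Q ^ j * a) * (1 - Q ^ j * b))) := fun j => by
    have := (hasSum_sum_range_mul_of_summable_norm (hgeom (hmul j hb))
      (hgeom (hmul j ha))).mul_left (w j)
    rw [tsum_geometric_of_norm_lt_one (hmul j hb), tsum_geometric_of_norm_lt_one (hmul j ha),
      ← mul_inv, mul_comm (1 - Q ^ j * b), ← div_eq_mul_inv] at this
    refine this.congr_fun ?_
    intro n
    rw [mul_assoc, hh, Finset.mul_sum]
    congr 1
    refine Finset.sum_congr rfl fun k hk => ?_
    obtain ⟨m, rfl⟩ := Nat.exists_eq_add_of_le (Nat.lt_succ_iff.1 (Finset.mem_range.1 hk))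
    rw [Nat.add_sub_cancel_left]
    ring
  have houter := hsum.hasSum.prod_fiberwise hinner
  refine ⟨houter.summable, ?_⟩
  have hcomm := hsum.tsum_comm' (f := fun j n => w j * (Q ^ n) ^ j * h n)
    (fun j => (hinner j).summable) (fun n => hsum.prod_symm.prod_factor n)
  simp_rw [tsum_mul_right, fun j => (hinner j).tsum_eq] at hcomm
  exact hcomm

theorem sum_range_two_mul_add_two {M : Type*} [AddCommMonoid M] (f : ℕ → M) (n : ℕ) :
    ∑ j ∈ range (2 * n + 2), f j = ∑ k ∈ range (n + 1), (f (2 * k) + f (2 * k + 1)) := by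
  induction n with
  | zero => simp [Finset.sum_range_succ]
  | succ n ih =>
    rw [Finset.sum_range_succ _ (n + 1), ← ih, show 2 * (n + 1) + 2 = 2 * n + 2 + 1 + 1 by ring,
      Finset.sum_range_succ, Finset.sum_range_succ, add_assoc]
    rfl

theorem rcpow_add (a : ℝ) (v w : ℂ) : rcpow a (v + w) = rcpow a v * rcpow a w := by
  rw [rcpow, add_mul, Complex.exp_add]; rfl

theorem rcpow_pow (a : ℝ) (w : ℂ) (n : ℕ) : rcpow a w ^ n = rcpow a (n * w) := by
  rw [rcpow, ← Complex.exp_nat_mul, ← mul_assoc]; rfl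

theorem ofReal_rpow_eq_rcpow {a : ℝ} (ha : 0 < a) (x : ℝ) : ((a ^ x : ℝ) : ℂ) = rcpow a x := by
  rw [Real.rpow_def_of_pos ha, rcpow]
  push_cast
  rw [mul_comm]

theorem norm_rcpow_lt_one {q : ℝ} (hq0 : 0 < q) (hq1 : q < 1) {w : ℂ} (hw : 0 < w.re) :
    ‖rcpow q w‖ < 1 := by
  rw [rcpow, Complex.norm_exp, Real.exp_lt_one_iff]
  simpa using mul_neg_of_pos_of_neg hw (Real.log_neg hq0 hq1)

theorem rcpow_qnum {q : ℝ} (hq0 : 0 < q) (hq1 : q < 1) (z : ℂ) (n : ℕ) :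
    rcpow (qnum q ((n : ℝ) + 1)) (-z) =
      rcpow q (n * z) * rcpow (1 - q ^ 2) z * rcpow (1 - (q ^ 2) ^ (n + 1)) (-z) := by
  have h2 : 0 < 1 - q ^ 2 := by nlinarith
  have hn : 0 < 1 - (q ^ 2) ^ (n + 1) :=
    sub_pos.2 (pow_lt_one₀ (by positivity) (by linarith) (by simp))
  have hnum : qnum q ((n : ℝ) + 1) = (1 - (q ^ 2) ^ (n + 1)) / (1 - q ^ 2) / q ^ n := by
    have hne : q - q⁻¹ ≠ 0 := by
      have := (one_lt_inv₀ hq0).2 hq1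
      linarith
    have hcast : (n : ℝ) + 1 = ((n + 1 : ℕ) : ℝ) := by push_cast; rfl
    rw [qnum, hcast, Real.rpow_neg hq0.le, Real.rpow_natCast, div_div, div_eq_div_iff hne
      (by positivity)]
    field_simp
    ring
  have hlog : Real.log (qnum q ((n : ℝ) + 1)) =
      Real.log (1 - (q ^ 2) ^ (n + 1)) - Real.log (1 - q ^ 2) - n * Real.log q := by
    rw [hnum, Real.log_div (by positivity) (by positivity), Real.log_div hn.ne' h2.ne',
      Real.log_pow]
  rw [rcpow, hlog]
  simp only [rcpow, ← Complex.exp_add]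
  push_cast
  ring_nf

theorem sum_qzetaTerm {q : ℝ} (hq0 : 0 < q) (hq1 : q < 1) (β δ : ℝ) (z : ℂ) (n : ℕ) :
    ∑ j ∈ range (2 * n + 2), qzetaTerm q β δ z n j =
      ((q ^ (β / 2) * (q ^ (-δ / 2) + q ^ (δ / 2)) : ℝ) : ℂ) * rcpow (1 - q ^ 2) z *
        (rcpow (1 - (q ^ 2) ^ (n + 1)) (-z) * ∑ k ∈ range (n + 1),
          rcpow q ((β + δ : ℝ) + z) ^ k * rcpow q ((β - δ : ℝ) + z) ^ (n - k)) := by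
  rw [sum_range_two_mul_add_two, Finset.mul_sum, Finset.mul_sum]
  refine Finset.sum_congr rfl fun k hk => ?_
  obtain ⟨m, rfl⟩ := Nat.exists_eq_add_of_le (Nat.lt_succ_iff.1 (Finset.mem_range.1 hk))
  rw [Nat.add_sub_cancel_left, qzetaTerm, qzetaTerm, rcpow_qnum hq0 hq1, rcpow_pow, rcpow_pow]
  set A := rcpow (1 - q ^ 2) z
  set B := rcpow (1 - (q ^ 2) ^ (k + m + 1)) (-z)
  have hfactor : q ^ (β * (((k + m : ℕ) : ℝ) + 1/2) +
        δ * (((2 * k : ℕ) : ℝ) - ((k + m : ℕ) : ℝ) - 1/2)) +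
      q ^ (β * (((k + m : ℕ) : ℝ) + 1/2) +
        δ * (((2 * k + 1 : ℕ) : ℝ) - ((k + m : ℕ) : ℝ) - 1/2)) =
      q ^ (β / 2) * (q ^ (-δ / 2) + q ^ (δ / 2)) * q ^ (k * (β + δ) + m * (β - δ)) := by
    rw [mul_add (q ^ _), add_mul]
    simp only [← Real.rpow_add hq0]
    push_cast
    congr 2 <;> ring
  have hbase : ((q ^ (k * (β + δ) + m * (β - δ)) : ℝ) : ℂ) * rcpow q (((k + m : ℕ) : ℂ) * z) =
      rcpow q (k * ((β + δ : ℝ) + z)) * rcpow q (m * ((β - δ : ℝ) + z)) := by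
    rw [ofReal_rpow_eq_rcpow hq0, ← rcpow_add, ← rcpow_add]
    congr 1
    push_cast
    ring
  rw [← add_mul, ← Complex.ofReal_add, hfactor, Complex.ofReal_mul _ (q ^ (_ + _))]
  linear_combination ((q ^ (β / 2) * (q ^ (-δ / 2) + q ^ (δ / 2)) : ℝ) : ℂ) * A * B * hbase

theorem Fterm_eq {q : ℝ} (hq0 : 0 < q) (β δ : ℝ) (z : ℂ) (j : ℕ) :
    Fterm q β δ z j = binomC z j * ((q ^ 2 : ℝ) : ℂ) ^ j /
      ((1 - ((q ^ 2 : ℝ) : ℂ) ^ j * rcpow q ((β - δ : ℝ) + z)) *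
        (1 - ((q ^ 2 : ℝ) : ℂ) ^ j * rcpow q ((β + δ : ℝ) + z))) := by
  have hshift : ∀ c : ℝ, rcpow q (((c + 2 * (j : ℝ) : ℝ) : ℂ) + z) =
      ((q ^ 2 : ℝ) : ℂ) ^ j * rcpow q (c + z) := fun c => by
    rw [← Complex.ofReal_pow, ← pow_mul, ← Real.rpow_natCast, ofReal_rpow_eq_rcpow hq0,
      ← rcpow_add]
    congr 1
    push_cast
    ring
  rw [Fterm, hshift, hshift, pow_mul, Complex.ofReal_pow]

theorem statement1 (q : ℝ) (hq0 : 0 < q) (hq1 : q < 1) (β δ : ℝ) (z : ℂ)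
    (hz : -β + |δ| < z.re) :
    Summable (fun j : ℕ => ‖Fterm q β δ z j‖) ∧
    qzeta q β δ z =
      ((q ^ (β / 2) * (q ^ (-δ / 2) + q ^ (δ / 2)) : ℝ) : ℂ) * rcpow (1 - q ^ 2) z *
        ∑' j : ℕ, Fterm q β δ z j := by
  have hq2 : q ^ 2 < 1 := pow_lt_one₀ hq0.le hq1 two_ne_zero
  have ha : ‖rcpow q ((β - δ : ℝ) + z)‖ < 1 := norm_rcpow_lt_one hq0 hq1 (by
    simp only [Complex.add_re, Complex.ofReal_re]
    linarith [le_abs_self δ])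
  have hb : ‖rcpow q ((β + δ : ℝ) + z)‖ < 1 := norm_rcpow_lt_one hq0 hq1 (by
    simp only [Complex.add_re, Complex.ofReal_re]
    linarith [neg_abs_le δ])
  have hQ : ‖((q ^ 2 : ℝ) : ℂ)‖ ≤ 1 := by
    rw [Complex.norm_real, Real.norm_of_nonneg (by positivity)]
    exact hq2.le
  obtain ⟨hsum, htsum⟩ := summable_and_tsum_mul_sum_pow
    (hasSum_binomC_mul_pow z (by positivity) hq2).summable.norm hQ ha hb
  simp_rw [← Fterm_eq hq0] at hsum htsum
  refine ⟨hsum.norm, ?_⟩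
  rw [qzeta, ← htsum, ← tsum_mul_left]
  refine tsum_congr fun n => ?_
  have hx1 : (q ^ 2) ^ (n + 1) < 1 := pow_lt_one₀ (by positivity) hq2 (by simp)
  rw [sum_qzetaTerm hq0 hq1, ← (hasSum_binomC_mul_pow z (by positivity) hx1).tsum_eq]
  congr 2
  refine tsum_congr fun j => ?_
  push_cast
  ring
end

section
/- Let β, δ ∈ ℝ with δ ≠ 0 and set z₀ := −β + |δ|. Then F_{β,δ} has at z₀ at most a simple pole, and lim_{z→z₀} (z−z₀)·F_{β,δ}(z) = q^{(β−|δ|)/2}·(1−q²)^{|δ|−β} / ((q^{|δ|}−1)·ln q). -/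
open Complex Real Filter Finset Topology

/-- The meromorphic continuation `F_{β,δ}`. -/
noncomputable def Ffun (q β δ : ℝ) (z : ℂ) : ℂ :=
  ((q ^ (β / 2) * (q ^ (-δ / 2) + q ^ (δ / 2)) : ℝ) : ℂ) * rcpow (1 - q ^ 2) z *
    ∑' j : ℕ, Fterm q β δ z j

theorem Ffun_abs (q β δ : ℝ) (z : ℂ) : Ffun q β |δ| z = Ffun q β δ z := by
  rcases abs_cases δ with ⟨h, -⟩ | ⟨h, -⟩
  · rw [h]
  · have hterm : ∀ j, Fterm q β (-δ) z j = Fterm q β δ z j := fun j => by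
      simp only [Fterm, sub_neg_eq_add, ← sub_eq_add_neg]
      rw [mul_comm (1 - rcpow q _)]
    simp only [h, Ffun, hterm, neg_neg]
    rw [add_comm (q ^ (δ / 2))]

theorem norm_rcpow_s4 {q : ℝ} (hq : 0 < q) (w : ℂ) : ‖rcpow q w‖ = q ^ w.re := by
  rw [rcpow, Complex.norm_exp, Complex.re_mul_ofReal, Real.rpow_def_of_pos hq, mul_comm]

theorem rcpow_ofReal {q : ℝ} (hq : 0 < q) (x : ℝ) : rcpow q x = ((q ^ x : ℝ) : ℂ) := by
  rw [rcpow, Real.rpow_def_of_pos hq, mul_comm]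
  push_cast
  rfl

theorem continuous_rcpow (a : ℝ) : Continuous (rcpow a) := by
  unfold rcpow
  fun_prop

theorem one_sub_le_norm_one_sub_rcpow {q : ℝ} (hq0 : 0 < q) (hq1 : q < 1) {w : ℂ}
    (hw : 1 ≤ w.re) : 1 - q ≤ ‖1 - rcpow q w‖ := by
  have h := norm_sub_norm_le (1 : ℂ) (rcpow q w)
  rw [norm_one, norm_rcpow_s4 hq0] at h
  have h' := Real.rpow_le_rpow_of_exponent_ge hq0 hq1.le hw
  rw [Real.rpow_one] at h'
  linarith

theorem norm_binomC_le {z : ℂ} {R : ℕ} (hz : ‖z‖ ≤ R + 1) (j : ℕ) :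
    ‖binomC z j‖ ≤ ((j + R).choose R : ℕ) := by
  have hfac : (0 : ℝ) < (j.factorial : ℝ) := by positivity
  rw [binomC, norm_div, Complex.norm_natCast, div_le_iff₀ hfac, norm_prod]
  calc ∏ i ∈ Finset.range j, ‖z + (i : ℂ)‖
      ≤ ∏ i ∈ Finset.range j, ((R : ℝ) + 1 + i) := by
        refine Finset.prod_le_prod (fun _ _ => norm_nonneg _) fun i _ => ?_
        refine (norm_add_le _ _).trans ?_
        rw [Complex.norm_natCast]
        linarith
    _ = ((R + 1).ascFactorial j : ℕ) := by
        rw [Nat.ascFactorial_eq_prod_range]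
        push_cast
        rfl
    _ = _ := by
        rw [Nat.ascFactorial_eq_factorial_mul_choose, add_comm R j, ← Nat.choose_symm_add]
        push_cast
        ring

/-- Away from the index `0`, the terms of `F_{β,d}` near `-β + d` are dominated by a
summable sequence. -/
theorem norm_Fterm_le {q : ℝ} (hq0 : 0 < q) (hq1 : q < 1) {β d : ℝ} (hd : 0 < d) {z : ℂ}
    {R : ℕ} (hz : ‖z‖ ≤ R + 1) (hre : -β + d - 1 ≤ z.re) {j : ℕ} (hj : j ≠ 0) :
    ‖Fterm q β d z j‖ ≤ ((j + R).choose R : ℕ) * (q ^ 2) ^ j / (1 - q) ^ 2 := by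
  have hj1 : (1 : ℝ) ≤ j := by exact_mod_cast Nat.one_le_iff_ne_zero.2 hj
  have h1 := one_sub_le_norm_one_sub_rcpow (w := ((β - d + 2 * (j : ℝ) : ℝ) : ℂ) + z) hq0 hq1
    (by rw [Complex.add_re, Complex.ofReal_re]; linarith)
  have h2 := one_sub_le_norm_one_sub_rcpow (w := ((β + d + 2 * (j : ℝ) : ℝ) : ℂ) + z) hq0 hq1
    (by rw [Complex.add_re, Complex.ofReal_re]; linarith)
  have hq : 0 < 1 - q := by linarith
  rw [Fterm, norm_div, norm_mul, norm_mul, norm_pow, Complex.norm_of_nonneg hq0.le, pow_mul,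
    sq (1 - q)]
  gcongr
  exact norm_binomC_le hz j

theorem tendsto_sub_div_one_sub_rcpow {q : ℝ} (hq0 : 0 < q) (hq1 : q < 1) (a : ℝ) :
    Tendsto (fun z : ℂ => (z - a) / (1 - rcpow q (((-a : ℝ) : ℂ) + z))) (𝓝[≠] (a : ℂ))
      (𝓝 (-(Real.log q : ℂ)⁻¹)) := by
  have hlog : (Real.log q : ℂ) ≠ 0 := by
    exact_mod_cast (Real.log_neg hq0 hq1).ne
  have hder : HasDerivAt (fun z : ℂ => rcpow q (((-a : ℝ) : ℂ) + z)) (Real.log q : ℂ) (a : ℂ) := by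
    have h := ((((hasDerivAt_id (a : ℂ)).const_add ((-a : ℝ) : ℂ)).mul_const
      (Real.log q : ℂ))).cexp
    simpa [rcpow] using h
  refine ((hasDerivAt_iff_tendsto_slope.1 hder).inv₀ hlog).neg.congr fun z => ?_
  have h1 : rcpow q (((-a : ℝ) : ℂ) + a) = 1 := by simp [rcpow]
  rw [slope_def_field, h1, inv_div, ← div_neg, neg_sub]

theorem tendsto_sub_mul_Fterm_zero {q : ℝ} (hq0 : 0 < q) (hq1 : q < 1) (β : ℝ) {d : ℝ}
    (hd : 0 < d) :
    Tendsto (fun z : ℂ => (z - ((-β + d : ℝ) : ℂ)) * Fterm q β d z 0)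
      (𝓝[≠] ((-β + d : ℝ) : ℂ))
      (𝓝 (-(Real.log q : ℂ)⁻¹ / (1 - ((q ^ (2 * d) : ℝ) : ℂ)))) := by
  have hne : (1 : ℂ) - ((q ^ (2 * d) : ℝ) : ℂ) ≠ 0 := by
    have := Real.rpow_lt_one hq0.le hq1 (by linarith : 0 < 2 * d)
    exact_mod_cast (sub_pos.2 this).ne'
  have hcont : Tendsto (fun z : ℂ => 1 - rcpow q (((β + d : ℝ) : ℂ) + z))
      (𝓝[≠] ((-β + d : ℝ) : ℂ)) (𝓝 (1 - ((q ^ (2 * d) : ℝ) : ℂ))) := by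
    have hc : Continuous fun z : ℂ => 1 - rcpow q (((β + d : ℝ) : ℂ) + z) :=
      continuous_const.sub ((continuous_rcpow q).comp (by fun_prop))
    have h := (hc.tendsto ((-β + d : ℝ) : ℂ)).mono_left
      (nhdsWithin_le_nhds (s := {((-β + d : ℝ) : ℂ)}ᶜ))
    rwa [← Complex.ofReal_add, rcpow_ofReal hq0, show β + d + (-β + d) = 2 * d by ring] at h
  refine ((tendsto_sub_div_one_sub_rcpow hq0 hq1 (-β + d)).div hcont hne).congr fun z => ?_
  simp only [Fterm, binomC, Finset.range_zero, Finset.prod_empty, Nat.factorial_zero,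
    Nat.cast_one, div_one, mul_zero, pow_zero, mul_one, Nat.cast_zero, add_zero, Pi.div_apply]
  rw [show -(-β + d) = β - d by ring, div_div, mul_one_div]

theorem tendsto_sub_mul_tsum_Fterm {q : ℝ} (hq0 : 0 < q) (hq1 : q < 1) (β : ℝ) {d : ℝ}
    (hd : 0 < d) :
    Tendsto (fun z : ℂ => (z - ((-β + d : ℝ) : ℂ)) * ∑' j, Fterm q β d z j)
      (𝓝[≠] ((-β + d : ℝ) : ℂ))
      (𝓝 (-(Real.log q : ℂ)⁻¹ / (1 - ((q ^ (2 * d) : ℝ) : ℂ)))) := by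
  set z₀ : ℂ := ((-β + d : ℝ) : ℂ) with hz₀
  set L : ℂ := -(Real.log q : ℂ)⁻¹ / (1 - ((q ^ (2 * d) : ℝ) : ℂ))
  obtain ⟨R, hR⟩ := exists_nat_ge ‖z₀‖
  set b : ℕ → ℝ := fun j => ((j + R).choose R : ℕ) * (q ^ 2) ^ j / (1 - q) ^ 2
  have hbsum : Summable b := by
    refine Summable.div_const ?_ _
    refine summable_choose_mul_geometric_of_norm_lt_one R ?_
    rw [Real.norm_of_nonneg (by positivity)]
    exact pow_lt_one₀ hq0.le hq1 two_ne_zero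
  have hnorm : Tendsto (fun z => ‖z - z₀‖) (𝓝[≠] z₀) (𝓝 0) :=
    (tendsto_norm_sub_self z₀).mono_left nhdsWithin_le_nhds
  have hball : ∀ᶠ z in 𝓝[≠] z₀, ‖z - z₀‖ < 1 := hnorm.eventually_lt_const one_pos
  have hbound : ∀ᶠ z in 𝓝[≠] z₀, ∀ j ≠ 0, ‖(z - z₀) * Fterm q β d z j‖ ≤ ‖z - z₀‖ * b j := by
    filter_upwards [hball] with z hz j hj
    rw [norm_mul]
    gcongr
    refine norm_Fterm_le hq0 hq1 hd ?_ ?_ hj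
    · have := norm_add_le (z - z₀) z₀
      rw [sub_add_cancel] at this
      linarith
    · have := (abs_le.1 ((Complex.abs_re_le_norm (z - z₀)).trans hz.le)).1
      rw [Complex.sub_re, hz₀, Complex.ofReal_re] at this
      linarith
  have hzero := tendsto_sub_mul_Fterm_zero hq0 hq1 β hd
  have hmain : Tendsto (fun z => ∑' j, (z - z₀) * Fterm q β d z j) (𝓝[≠] z₀)
      (𝓝 (∑' j, Pi.single (M := fun _ => ℂ) 0 L j)) := by
    refine tendsto_tsum_of_dominated_convergence
      (bound := fun j => b j + Pi.single (M := fun _ => ℝ) 0 (‖L‖ + 1) j)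
      (hbsum.add (hasSum_pi_single 0 _).summable) (fun j => ?_) ?_
    · rcases eq_or_ne j 0 with rfl | hj
      · rw [Pi.single_eq_same]
        exact hzero
      · rw [Pi.single_eq_of_ne hj]
        refine squeeze_zero_norm' (hbound.mono fun z hz => hz j hj) ?_
        simpa using hnorm.mul_const (b j)
    · filter_upwards [hbound, hball, hzero.norm.eventually_le_const (lt_add_one ‖L‖)]
        with z hz hz1 hz0 j
      have hbj : 0 ≤ b j := by positivity
      rcases eq_or_ne j 0 with rfl | hj
      · rw [Pi.single_eq_same]
        linarith
      · rw [Pi.single_eq_of_ne hj, add_zero]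
        exact (hz j hj).trans (mul_le_of_le_one_left hbj hz1.le)
  rw [tsum_pi_single] at hmain
  simpa only [tsum_mul_left] using hmain

theorem residue_constant {q : ℝ} (hq0 : 0 < q) (hq1 : q < 1) (β : ℝ) {d : ℝ} (hd : 0 < d) :
    q ^ (β / 2) * (q ^ (-d / 2) + q ^ (d / 2)) * (1 - q ^ 2) ^ (-β + d) *
        (-(Real.log q)⁻¹ / (1 - q ^ (2 * d))) =
      q ^ ((β - d) / 2) * (1 - q ^ 2) ^ (d - β) / ((q ^ d - 1) * Real.log q) := by
  have hlog : Real.log q ≠ 0 := (Real.log_neg hq0 hq1).ne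
  have hlt : q ^ d < 1 := Real.rpow_lt_one hq0.le hq1 hd
  have hpos : 0 < q ^ d := Real.rpow_pos_of_pos hq0 d
  have h1 : q ^ (β / 2) * (q ^ (-d / 2) + q ^ (d / 2)) = q ^ ((β - d) / 2) * (1 + q ^ d) := by
    rw [mul_add, mul_add, ← Real.rpow_add hq0, ← Real.rpow_add hq0, ← Real.rpow_add hq0, mul_one]
    ring_nf
  have h2 : 1 - q ^ (2 * d) = (1 - q ^ d) * (1 + q ^ d) := by
    rw [two_mul, Real.rpow_add hq0]
    ring
  have h3 : 1 - q ^ d ≠ 0 := by linarith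
  have h4 : q ^ d - 1 ≠ 0 := by linarith
  have h5 : 1 + q ^ d ≠ 0 := by positivity
  rw [h1, h2, neg_add_eq_sub, ← neg_sub 1 (q ^ d)]
  field_simp

theorem statement4 (q : ℝ) (hq0 : 0 < q) (hq1 : q < 1) (β δ : ℝ) (hδ : δ ≠ 0) :
    Tendsto (fun z : ℂ => (z - ((-β + |δ| : ℝ) : ℂ)) * Ffun q β δ z)
      (𝓝[≠] ((-β + |δ| : ℝ) : ℂ))
      (𝓝 ((q ^ ((β - |δ|) / 2) * (1 - q ^ 2) ^ (|δ| - β) /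
        ((q ^ |δ| - 1) * Real.log q) : ℝ) : ℂ)) := by
  have hd : 0 < |δ| := abs_pos.2 hδ
  have hc := ((continuous_rcpow (1 - q ^ 2)).tendsto ((-β + |δ| : ℝ) : ℂ)).mono_left
    (nhdsWithin_le_nhds (s := {((-β + |δ| : ℝ) : ℂ)}ᶜ))
  have hpos : 0 < 1 - q ^ 2 := sub_pos.2 (pow_lt_one₀ hq0.le hq1 two_ne_zero)
  rw [rcpow_ofReal hpos] at hc
  have h := (hc.const_mul
    ((q ^ (β / 2) * (q ^ (-|δ| / 2) + q ^ (|δ| / 2)) : ℝ) : ℂ)).mul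
      (tendsto_sub_mul_tsum_Fterm hq0 hq1 β hd)
  rw [← residue_constant hq0 hq1 β hd]
  convert h using 2 with z
  · rw [← Ffun_abs, Ffun]
    ring
  · push_cast
    rfl
end

section
/- There exists a constant C > 0 such that for every half-integer l ∈ {3/2, 5/2, 7/2, …}, every k with k + l ∈ ℤ and |k| ≤ l, and every sign s ∈ {+1, −1}, one has |α⁻₀(l,k)_s| ≤ C·q^l. -/
open Real

/-- The coefficient `α⁻₀(l,k)_s` of the Dąbrowski–Sitarz spectral triple. -/
noncomputable def alphaMinus (q l k s : ℝ) : ℝ :=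
  q ^ (k + s / 2) * qnum q 2 * Real.sqrt (qnum q (l - k)) * Real.sqrt (qnum q (l + k)) *
    Real.sqrt (qnum q (l - 1/2)) * Real.sqrt (qnum q (l + 1/2)) /
    (Real.sqrt (qnum q (2 * l - 1)) * qnum q (2 * l) * Real.sqrt (qnum q (2 * l + 1)))

/-- The coefficient `β_s(l)` of the Dąbrowski–Sitarz spectral triple. -/
noncomputable def betaCoef (q l s : ℝ) : ℝ :=
  (s * q ^ (-s) + (q - q⁻¹) * (qnum q (1/2) * qnum q (3/2) - qnum q l * qnum q (l + 1))) /
    (q * qnum q (2 * l + 2))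

/-- The coefficient `α⁰₀(l,k)_s` of the Dąbrowski–Sitarz spectral triple. -/
noncomputable def alphaZero (q l k s : ℝ) : ℝ :=
  (qnum q (2 * l))⁻¹ *
    (qnum q (l - k + 1) * qnum q (l + k) - q ^ 2 * qnum q (l - k) * qnum q (l + k + 1)) *
    betaCoef q l s

lemma inv_sub_self_pos {q : ℝ} (hq0 : 0 < q) (hq1 : q < 1) : 0 < q⁻¹ - q := by
  have := (one_lt_inv₀ hq0).2 hq1
  linarith

lemma qnum_eq (q x : ℝ) : qnum q x = (q ^ (-x) - q ^ x) / (q⁻¹ - q) := by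
  rw [qnum, ← neg_sub (q ^ (-x)), ← neg_sub q⁻¹, neg_div_neg_eq]

lemma sqrt_qnum_le {q : ℝ} (hq0 : 0 < q) (hq1 : q < 1) (x : ℝ) :
    √(qnum q x) ≤ (√(q⁻¹ - q))⁻¹ * q ^ (-x / 2) := by
  have hD := inv_sub_self_pos hq0 hq1
  have hle : qnum q x ≤ (q⁻¹ - q)⁻¹ * q ^ (-x) := by
    rw [qnum_eq, div_eq_inv_mul]
    have := rpow_pos_of_pos hq0 x
    gcongr
    linarith
  refine (Real.sqrt_le_sqrt hle).trans_eq ?_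
  rw [Real.sqrt_mul (by positivity), Real.sqrt_inv, Real.sqrt_eq_rpow (q ^ (-x)),
    ← rpow_mul hq0.le, mul_one_div]

lemma rpow_le_qnum {q : ℝ} (hq0 : 0 < q) (hq1 : q < 1) {x : ℝ} (hx : 1 ≤ x) :
    q ^ (1 - x) ≤ qnum q x := by
  rw [qnum_eq, le_div_iff₀ (inv_sub_self_pos hq0 hq1), mul_sub, ← div_eq_mul_inv]
  have h₁ : q ^ (1 - x) / q = q ^ (-x) := by
    rw [← rpow_sub_one hq0.ne']
    ring_nf
  have h₂ : q ^ (1 - x) * q = q ^ (2 - x) := by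
    rw [← rpow_add_one hq0.ne']
    ring_nf
  have h₃ : q ^ x ≤ q ^ (2 - x) := rpow_le_rpow_of_exponent_ge hq0 hq1.le (by linarith)
  rw [h₁, h₂]
  linarith

lemma rpow_le_sqrt_qnum {q : ℝ} (hq0 : 0 < q) (hq1 : q < 1) {x : ℝ} (hx : 1 ≤ x) :
    q ^ ((1 - x) / 2) ≤ √(qnum q x) := by
  refine le_trans (le_of_eq ?_) (Real.sqrt_le_sqrt (rpow_le_qnum hq0 hq1 hx))
  rw [Real.sqrt_eq_rpow, ← rpow_mul hq0.le, mul_one_div]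

lemma abs_alphaMinus_le {q : ℝ} (hq0 : 0 < q) (hq1 : q < 1) {l : ℝ} (hl : 1 ≤ l) (k s : ℝ) :
    |alphaMinus q l k s| ≤
      (√(q⁻¹ - q))⁻¹ ^ 4 * qnum q 2 * q ^ (k + s / 2 + 2 * l - 2) := by
  have h2 : 0 < qnum q 2 := (rpow_pos_of_pos hq0 _).trans_le (rpow_le_qnum hq0 hq1 one_le_two)
  have h2l : 0 < qnum q (2 * l) :=
    (rpow_pos_of_pos hq0 _).trans_le (rpow_le_qnum hq0 hq1 (by linarith))
  rw [alphaMinus, abs_of_nonneg (by positivity)]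
  set c := (√(q⁻¹ - q))⁻¹
  have hden : q ^ ((1 - (2 * l - 1)) / 2) * q ^ (1 - 2 * l) * q ^ ((1 - (2 * l + 1)) / 2) ≤
      √(qnum q (2 * l - 1)) * qnum q (2 * l) * √(qnum q (2 * l + 1)) := by
    gcongr
    · exact rpow_le_sqrt_qnum hq0 hq1 (by linarith)
    · exact rpow_le_qnum hq0 hq1 (by linarith)
    · exact rpow_le_sqrt_qnum hq0 hq1 (by linarith)
  have hnum : q ^ (k + s / 2) * qnum q 2 * √(qnum q (l - k)) * √(qnum q (l + k)) *
      √(qnum q (l - 1/2)) * √(qnum q (l + 1/2)) ≤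
      q ^ (k + s / 2) * qnum q 2 * (c * q ^ (-(l - k) / 2)) * (c * q ^ (-(l + k) / 2)) *
        (c * q ^ (-(l - 1/2) / 2)) * (c * q ^ (-(l + 1/2) / 2)) := by
    gcongr <;> exact sqrt_qnum_le hq0 hq1 _
  refine (div_le_div₀ (by positivity) hnum (by positivity) hden).trans_eq ?_
  rw [div_eq_iff (by positivity)]
  calc _ = c ^ 4 * qnum q 2 * (q ^ (k + s / 2) * q ^ (-(l - k) / 2) * q ^ (-(l + k) / 2) *
        q ^ (-(l - 1/2) / 2) * q ^ (-(l + 1/2) / 2)) := by ring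
    _ = c ^ 4 * qnum q 2 * (q ^ (k + s / 2 + 2 * l - 2) *
        (q ^ ((1 - (2 * l - 1)) / 2) * q ^ (1 - 2 * l) * q ^ ((1 - (2 * l + 1)) / 2))) := by
      simp only [← rpow_add hq0]
      ring_nf
    _ = _ := by ring

theorem statement9 (q : ℝ) (hq0 : 0 < q) (hq1 : q < 1) :
    ∃ C : ℝ, 0 < C ∧ ∀ (n : ℕ) (k s : ℝ),
      (∃ m : ℤ, k + ((n : ℝ) + 3/2) = (m : ℝ)) → |k| ≤ (n : ℝ) + 3/2 →
      (s = 1 ∨ s = -1) →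
      |alphaMinus q ((n : ℝ) + 3/2) k s| ≤ C * q ^ ((n : ℝ) + 3/2) := by
  have hD := inv_sub_self_pos hq0 hq1
  have h2 : 0 < qnum q 2 := (rpow_pos_of_pos hq0 _).trans_le (rpow_le_qnum hq0 hq1 one_le_two)
  refine ⟨(√(q⁻¹ - q))⁻¹ ^ 4 * qnum q 2 * q ^ (-(5 / 2) : ℝ), by positivity, ?_⟩
  intro n k s _ hk hs
  have hn : (0 : ℝ) ≤ n := n.cast_nonneg
  refine (abs_alphaMinus_le hq0 hq1 (by linarith) k s).trans ?_
  rw [mul_assoc _ (q ^ (-(5 / 2) : ℝ)), ← rpow_add hq0]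
  refine mul_le_mul_of_nonneg_left ?_ (by positivity)
  refine rpow_le_rpow_of_exponent_ge hq0 hq1.le ?_
  have := (abs_le.1 hk).1
  rcases hs with rfl | rfl <;> linarith
end

section
/- There exists a constant C > 0 such that for every half-integer l ∈ {1/2, 3/2, 5/2, …} and every sign s ∈ {+1, −1}, one has |β_s(l) − 1| ≤ C·q^{2l}. -/
open Real

/-- The product of two q-numbers as a single fraction. -/
lemma qnum_mul_qnum {q : ℝ} (hq : 0 < q) (x y : ℝ) :
    qnum q x * qnum q y =
      (q ^ (x + y) + q ^ (-(x + y)) - q ^ (x - y) - q ^ (-(x - y))) / (q - q⁻¹) ^ 2 := by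
  rw [qnum, qnum, div_mul_div_comm, ← sq (q - q⁻¹)]
  congr 1
  rw [show -(x + y) = -x + -y by ring, show x - y = x + -y by ring,
    show -(x + -y) = -x + y by ring]
  simp only [rpow_add hq]
  ring

/-- Closed form of the deviation of `β_s(l)` from `1` in terms of `t = q^{2l}`. -/
lemma betaCoef_sub_one {q : ℝ} (hq0 : 0 < q) (hq1 : q < 1) {l : ℝ} (hl : 0 ≤ l) (s : ℝ) :
    betaCoef q l s - 1 =
      -((q - q⁻¹) * (s * q ^ (-s)) + q ^ 2 + (q ^ 2)⁻¹
        - (q * q ^ (2 * l) + q ^ 3 * q ^ (2 * l))) * q * q ^ (2 * l) /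
        (1 - q ^ 4 * (q ^ (2 * l)) ^ 2) := by
  have ht0 : 0 < q ^ (2 * l) := rpow_pos_of_pos hq0 _
  have ht1 : q ^ (2 * l) ≤ 1 := rpow_le_one hq0.le hq1.le (by linarith)
  have hd : q - q⁻¹ ≠ 0 := by
    have := (one_lt_inv₀ hq0).2 hq1
    linarith
  have hconst : qnum q (1/2) * qnum q (3/2) =
      (q ^ 2 + (q ^ 2)⁻¹ - q - q⁻¹) / (q - q⁻¹) ^ 2 := by
    rw [qnum_mul_qnum hq0]
    norm_num [rpow_neg hq0.le]
    ring
  have hprod : qnum q l * qnum q (l + 1) =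
      (q * q ^ (2 * l) + (q * q ^ (2 * l))⁻¹ - q - q⁻¹) / (q - q⁻¹) ^ 2 := by
    rw [qnum_mul_qnum hq0, show l + (l + 1) = 1 + 2 * l by ring, show l - (l + 1) = -1 by ring,
      rpow_neg hq0.le (1 + 2 * l), rpow_add hq0, neg_neg, rpow_neg_one, rpow_one]
    ring
  have hden : qnum q (2 * l + 2) =
      (q ^ 2 * q ^ (2 * l) - (q ^ 2 * q ^ (2 * l))⁻¹) / (q - q⁻¹) := by
    rw [qnum, rpow_neg hq0.le, rpow_add hq0, rpow_two, mul_comm (q ^ 2)]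
  rw [betaCoef, hconst, hprod, hden]
  generalize q ^ (2 * l) = t at *
  generalize s * q ^ (-s) = u
  have hlt : q ^ 4 * t ^ 2 < 1 :=
    mul_lt_one_of_nonneg_of_lt_one_left (by positivity) (pow_lt_one₀ hq0.le hq1 (by norm_num))
      (pow_le_one₀ ht0.le ht1)
  have hne : 1 - q ^ 4 * t ^ 2 ≠ 0 := by linarith
  have hqt : q ^ 2 * t - (q ^ 2 * t)⁻¹ = -(1 - q ^ 4 * t ^ 2) / (q ^ 2 * t) := by
    field_simp
    ring
  have hnum : u + (q - q⁻¹) * ((q ^ 2 + (q ^ 2)⁻¹ - q - q⁻¹) / (q - q⁻¹) ^ 2 -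
      (q * t + (q * t)⁻¹ - q - q⁻¹) / (q - q⁻¹) ^ 2) =
      ((q - q⁻¹) * u + q ^ 2 + (q ^ 2)⁻¹ - q * t - (q * t)⁻¹) / (q - q⁻¹) := by
    generalize q - q⁻¹ = d at *
    field_simp
    ring
  rw [hnum, hqt]
  generalize q - q⁻¹ = d at *
  generalize hr : 1 - q ^ 4 * t ^ 2 = r at *
  field_simp
  rw [← hr]
  ring

theorem statement10 (q : ℝ) (hq0 : 0 < q) (hq1 : q < 1) :
    ∃ C : ℝ, 0 < C ∧ ∀ (n : ℕ) (s : ℝ), (s = 1 ∨ s = -1) →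
      |betaCoef q ((n : ℝ) + 1/2) s - 1| ≤ C * q ^ (2 * ((n : ℝ) + 1/2)) := by
  have hq4 : q ^ 4 < 1 := pow_lt_one₀ hq0.le hq1 (by norm_num)
  have hq2 : q ^ 2 < 1 := pow_lt_one₀ hq0.le hq1 (by norm_num)
  have hq3 : q ^ 3 < 1 := pow_lt_one₀ hq0.le hq1 (by norm_num)
  have hinv : 0 < (q ^ 2)⁻¹ := by positivity
  have hgap : 0 < 1 - q ^ 4 := by linarith
  refine ⟨(2 + (q ^ 2)⁻¹) / (1 - q ^ 4), by positivity, fun n s hs => ?_⟩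
  have hl : (0 : ℝ) ≤ (n : ℝ) + 1/2 := by positivity
  have ht0 : 0 < q ^ (2 * ((n : ℝ) + 1/2)) := rpow_pos_of_pos hq0 _
  have ht1 : q ^ (2 * ((n : ℝ) + 1/2)) ≤ 1 := rpow_le_one hq0.le hq1.le (by linarith)
  rw [betaCoef_sub_one hq0 hq1 hl]
  generalize q ^ (2 * ((n : ℝ) + 1/2)) = t at *
  have hK : 0 ≤ (q - q⁻¹) * (s * q ^ (-s)) + q ^ 2 + (q ^ 2)⁻¹ ∧
      (q - q⁻¹) * (s * q ^ (-s)) + q ^ 2 + (q ^ 2)⁻¹ ≤ 2 + (q ^ 2)⁻¹ := by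
    rcases hs with rfl | rfl
    · have : (q - q⁻¹) * (1 * q ^ (-1 : ℝ)) + q ^ 2 + (q ^ 2)⁻¹ = 1 + q ^ 2 := by
        rw [rpow_neg_one]
        field_simp
        ring
      rw [this]
      constructor <;> nlinarith
    · have : (q - q⁻¹) * (-1 * q ^ (-(-1) : ℝ)) + q ^ 2 + (q ^ 2)⁻¹ = 1 + (q ^ 2)⁻¹ := by
        rw [neg_neg, rpow_one]
        field_simp
        ring
      rw [this]
      constructor <;> linarith
  generalize (q - q⁻¹) * (s * q ^ (-s)) + q ^ 2 + (q ^ 2)⁻¹ = K at *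
  have hqt : q * t ≤ 1 := mul_le_one₀ hq1.le ht0.le ht1
  have hq3t : q ^ 3 * t ≤ 1 := mul_le_one₀ hq3.le ht0.le ht1
  have hqt0 : 0 < q * t := by positivity
  have hq3t0 : 0 < q ^ 3 * t := by positivity
  have hfactor : |K - (q * t + q ^ 3 * t)| ≤ 2 + (q ^ 2)⁻¹ :=
    abs_le.2 ⟨by linarith [hK.1], by linarith [hK.2]⟩
  have hdenom : 1 - q ^ 4 ≤ 1 - q ^ 4 * t ^ 2 := by
    have : q ^ 4 * t ^ 2 ≤ q ^ 4 :=
      mul_le_of_le_one_right (by positivity) (pow_le_one₀ ht0.le ht1)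
    linarith
  rw [abs_div, abs_mul, abs_mul, abs_neg, abs_of_pos hq0, abs_of_pos ht0,
    abs_of_pos (hgap.trans_le hdenom), div_mul_eq_mul_div]
  gcongr
  exact (mul_le_of_le_one_right (abs_nonneg _) hq1.le).trans hfactor
end

section
/- There exists a constant C > 0 such that for every half-integer l ∈ {1/2, 3/2, 5/2, …}, every k with k + l ∈ ℤ and |k| ≤ l, and every sign s ∈ {+1, −1}, one has |α⁰₀(l,k)_s − 1 + (1+q²)·q^{2l+2k}| ≤ C·q^{2l}. -/
open Real

/-- The linear coefficient in `q ^ (2 * l)` of the numerator of `betaCoef q l s`. -/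
noncomputable def betaLinearCoef (q s : ℝ) : ℝ :=
  q * ((q - q⁻¹) * (s * q ^ (-s)) + (q - q⁻¹) ^ 2 * (qnum q (1/2) * qnum q (3/2)) + q + q⁻¹)

lemma sub_inv_ne_zero_of_lt_one {q : ℝ} (hq0 : 0 < q) (hq1 : q < 1) : q - q⁻¹ ≠ 0 := by
  have := (one_lt_inv₀ hq0).2 hq1
  linarith

lemma qnum_factor_eq {q : ℝ} (hq0 : 0 < q) (hq1 : q < 1) {l : ℝ} (hl : 0 < l) (k : ℝ) :
    (qnum q (2 * l))⁻¹ *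
      (qnum q (l - k + 1) * qnum q (l + k) - q ^ 2 * qnum q (l - k) * qnum q (l + k + 1)) =
    (1 + q ^ 2 * (q ^ (2 * l)) ^ 2 - (1 + q ^ 2) * q ^ (2 * l + 2 * k)) /
      (1 - (q ^ (2 * l)) ^ 2) := by
  have hd := sub_inv_ne_zero_of_lt_one hq0 hq1
  have hL : 0 < q ^ l := rpow_pos_of_pos hq0 l
  have hK : 0 < q ^ k := rpow_pos_of_pos hq0 k
  have hL1 : q ^ l < 1 := rpow_lt_one hq0.le hq1 hl
  simp only [qnum, rpow_neg hq0.le, rpow_add hq0, rpow_sub hq0, rpow_one, two_mul]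
  generalize q ^ l = L at *
  generalize q ^ k = K at *
  have hL2 : L * L < 1 := by nlinarith
  have h1 : 1 - (L * L) ^ 2 ≠ 0 := by nlinarith [mul_pos hL hL]
  have h2 : L * L - (L * L)⁻¹ ≠ 0 := sub_inv_ne_zero_of_lt_one (mul_pos hL hL) hL2
  have h3 : L * L - (L * L)⁻¹ = -(1 - (L * L) ^ 2) / (L * L) := by field_simp; ring
  have h4 : q - q⁻¹ = -(1 - q ^ 2) / q := by field_simp; ring
  have h5 : 1 - q ^ 2 ≠ 0 := by nlinarith
  rw [h3, h4]
  field_simp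
  ring

lemma betaCoef_eq {q : ℝ} (hq0 : 0 < q) (hq1 : q < 1) {l : ℝ} (hl : 0 < l) (s : ℝ) :
    betaCoef q l s =
    (1 + q ^ 2 * (q ^ (2 * l)) ^ 2 - betaLinearCoef q s * q ^ (2 * l)) /
      (1 - q ^ 4 * (q ^ (2 * l)) ^ 2) := by
  have hL : 0 < q ^ l := rpow_pos_of_pos hq0 l
  have hL1 : q ^ l < 1 := rpow_lt_one hq0.le hq1 hl
  have hc : q ^ (2 * l + 2) = q ^ l * q ^ l * q ^ 2 := by
    rw [rpow_add hq0, two_mul, rpow_add hq0, rpow_two]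
  unfold betaCoef betaLinearCoef
  generalize qnum q (1/2) * qnum q (3/2) = c
  generalize s * q ^ (-s) = t
  simp only [qnum, rpow_neg hq0.le, hc]
  simp only [rpow_add hq0, rpow_one, two_mul]
  generalize q ^ l = L at *
  have hL2 : L * L < 1 := by nlinarith
  have hL3 : (L * L) ^ 2 < 1 := by nlinarith [mul_pos hL hL]
  have hq4 : q ^ 4 < 1 := pow_lt_one₀ hq0.le hq1 (by norm_num)
  have h1 : 1 - q ^ 4 * (L * L) ^ 2 ≠ 0 := by
    nlinarith [sq_nonneg (L * L), pow_pos hq0 4]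
  have h3 : L * L * q ^ 2 - (L * L * q ^ 2)⁻¹ =
      -(1 - q ^ 4 * (L * L) ^ 2) / (L * L * q ^ 2) := by field_simp; ring
  have h4 : q - q⁻¹ = -(1 - q ^ 2) / q := by field_simp; ring
  have h5 : 1 - q ^ 2 ≠ 0 := by nlinarith
  rw [h3, h4]
  field_simp
  ring

lemma abs_qnum_factor_sub_le {q x z : ℝ} (hq0 : 0 < q) (hq1 : q < 1) (hx0 : 0 < x) (hx : x ≤ q)
    (hz0 : 0 < z) (hz1 : z ≤ 1) :
    |(1 + q ^ 2 * x ^ 2 - (1 + q ^ 2) * z) / (1 - x ^ 2) - (1 - (1 + q ^ 2) * z)| ≤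
      2 / (1 - q ^ 2) * x := by
  have hδ : 0 < 1 - q ^ 2 := by nlinarith
  have hx2 : 1 - q ^ 2 ≤ 1 - x ^ 2 := by nlinarith
  have h : (1 + q ^ 2 * x ^ 2 - (1 + q ^ 2) * z) / (1 - x ^ 2) - (1 - (1 + q ^ 2) * z) =
      ((1 + q ^ 2) * (1 - z) * x) * x / (1 - x ^ 2) := by
    have : 1 - x ^ 2 ≠ 0 := by linarith
    field_simp
    ring
  have h0 : 0 ≤ (1 + q ^ 2) * (1 - z) := mul_nonneg (by positivity) (by linarith)
  have h1 : (1 + q ^ 2) * (1 - z) ≤ 2 := by nlinarith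
  have h2 : (1 + q ^ 2) * (1 - z) * x ≤ 2 := by nlinarith
  rw [h, abs_of_nonneg (div_nonneg (by positivity) (by linarith)), div_mul_eq_mul_div]
  gcongr

lemma abs_beta_sub_one_le {q x : ℝ} (g : ℝ) (hq0 : 0 < q) (hq1 : q < 1) (hx0 : 0 < x)
    (hx : x ≤ q) :
    |(1 + q ^ 2 * x ^ 2 - g * x) / (1 - q ^ 4 * x ^ 2) - 1| ≤ (2 + |g|) / (1 - q ^ 2) * x := by
  have hδ : 0 < 1 - q ^ 2 := by nlinarith
  have hq2 : q ^ 2 < 1 := by linarith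
  have hq4 : q ^ 4 < 1 := pow_lt_one₀ hq0.le hq1 (by norm_num)
  have hx2 : 1 - q ^ 2 ≤ 1 - q ^ 4 * x ^ 2 := by nlinarith [sq_nonneg x]
  have h : (1 + q ^ 2 * x ^ 2 - g * x) / (1 - q ^ 4 * x ^ 2) - 1 =
      ((q ^ 2 + q ^ 4) * x - g) * x / (1 - q ^ 4 * x ^ 2) := by
    have : 1 - q ^ 4 * x ^ 2 ≠ 0 := by linarith
    field_simp
    ring
  have h1 : |(q ^ 2 + q ^ 4) * x - g| ≤ 2 + |g| := by
    refine (abs_sub _ _).trans ?_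
    rw [abs_of_nonneg (by positivity)]
    nlinarith [pow_pos hq0 2, pow_pos hq0 4]
  rw [h, abs_div, abs_mul, abs_of_pos hx0, abs_of_pos (hδ.trans_le hx2), div_mul_eq_mul_div]
  gcongr

lemma abs_mul_sub_le {T F b r e x : ℝ} (hT : |T| ≤ 2) (hF : |F - T| ≤ r * x)
    (hb : |b - 1| ≤ e * x) (hr : 0 ≤ r) (hx1 : x ≤ 1) :
    |F * b - T| ≤ (2 * e + r * e + r) * x := by
  have h : F * b - T = T * (b - 1) + (F - T) * (b - 1) + (F - T) := by ring
  have h1 : |T| * |b - 1| ≤ 2 * (e * x) := by gcongr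
  have h2 : |F - T| * |b - 1| ≤ r * 1 * (e * x) :=
    mul_le_mul (hF.trans (by gcongr)) hb (abs_nonneg _) (by positivity)
  rw [h]
  refine (abs_add_three _ _ _).trans ?_
  rw [abs_mul, abs_mul]
  linarith

theorem statement11 (q : ℝ) (hq0 : 0 < q) (hq1 : q < 1) :
    ∃ C : ℝ, 0 < C ∧ ∀ (n : ℕ) (k s : ℝ),
      (∃ m : ℤ, k + ((n : ℝ) + 1/2) = (m : ℝ)) → |k| ≤ (n : ℝ) + 1/2 →
      (s = 1 ∨ s = -1) →
      |alphaZero q ((n : ℝ) + 1/2) k s - 1 + (1 + q ^ 2) * q ^ (2 * ((n : ℝ) + 1/2) + 2 * k)| ≤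
        C * q ^ (2 * ((n : ℝ) + 1/2)) := by
  have hδ : 0 < 1 - q ^ 2 := by nlinarith
  set G := |betaLinearCoef q 1| + |betaLinearCoef q (-1)|
  have hG : 0 ≤ G := by positivity
  set r := 2 / (1 - q ^ 2)
  set e := (2 + G) / (1 - q ^ 2)
  have hr : 0 < r := by positivity
  have he : 0 < e := by positivity
  refine ⟨2 * e + r * e + r, by positivity, fun n k s _ hk hs => ?_⟩
  have hl : (0 : ℝ) < n + 1/2 := by positivity
  have hgs : |betaLinearCoef q s| ≤ G := by
    rcases hs with rfl | rfl
    · exact le_add_of_nonneg_right (abs_nonneg _)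
    · exact le_add_of_nonneg_left (abs_nonneg _)
  rw [alphaZero, qnum_factor_eq hq0 hq1 hl, betaCoef_eq hq0 hq1 hl, sub_add]
  have hx0 : 0 < q ^ (2 * ((n : ℝ) + 1/2)) := rpow_pos_of_pos hq0 _
  have hxq : q ^ (2 * ((n : ℝ) + 1/2)) ≤ q := by
    conv_rhs => rw [← rpow_one q]
    exact rpow_le_rpow_of_exponent_ge hq0 hq1.le (by linarith [n.cast_nonneg (α := ℝ)])
  have hz0 : 0 < q ^ (2 * ((n : ℝ) + 1/2) + 2 * k) := rpow_pos_of_pos hq0 _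
  have hz1 : q ^ (2 * ((n : ℝ) + 1/2) + 2 * k) ≤ 1 :=
    rpow_le_one hq0.le hq1.le (by linarith [(abs_le.1 hk).1])
  generalize q ^ (2 * ((n : ℝ) + 1/2) + 2 * k) = z at *
  generalize q ^ (2 * ((n : ℝ) + 1/2)) = x at *
  refine abs_mul_sub_le ?_ (abs_qnum_factor_sub_le hq0 hq1 hx0 hxq hz0 hz1)
    ((abs_beta_sub_one_le _ hq0 hq1 hx0 hxq).trans ?_) hr.le (hxq.trans hq1.le)
  · rw [abs_le]
    constructor <;> nlinarith
  · unfold e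
    gcongr
end

section
/- There exists a constant C > 0 such that for every half-integer l ∈ {1/2, 3/2, 5/2, …} and every k with k + l ∈ ℤ and |k| ≤ l, one has |([l−k+1]_q[l+k]_q − q²[l−k]_q[l+k+1]_q)/[2l]_q − 1 + (1+q²)·q^{2l+2k}| ≤ C·q^{2l}. -/
open Real

/-- With `a = q^(l-k)` and `b = q^(l+k)`, the exact value of the deviation. -/
lemma deviation_eq {q a b : ℝ} (hq : q ≠ 0) (hq2 : 1 - q ^ 2 ≠ 0) (ha : a ≠ 0) (hb : b ≠ 0)
    (hab : 1 - (a * b) ^ 2 ≠ 0) :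
    ((a * q - (a * q)⁻¹) / (q - q⁻¹) * ((b - b⁻¹) / (q - q⁻¹)) -
        q ^ 2 * ((a - a⁻¹) / (q - q⁻¹)) * ((b * q - (b * q)⁻¹) / (q - q⁻¹))) /
        ((a * b - (a * b)⁻¹) / (q - q⁻¹)) - 1 + (1 + q ^ 2) * b ^ 2 =
      (1 + q ^ 2) * (a * b) ^ 2 * (1 - b ^ 2) / (1 - (a * b) ^ 2) := by
  have hd : q - q⁻¹ = -(1 - q ^ 2) / q := by field_simp; ring
  have ht : a * b - (a * b)⁻¹ = -(1 - (a * b) ^ 2) / (a * b) := by field_simp; ring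
  rw [hd, ht]
  generalize hu : 1 - q ^ 2 = u at *
  generalize hv : 1 - (a * b) ^ 2 = v at *
  field_simp
  subst hu hv
  ring

theorem statement12 (q : ℝ) (hq0 : 0 < q) (hq1 : q < 1) :
    ∃ C : ℝ, 0 < C ∧ ∀ (n : ℕ) (k : ℝ),
      (∃ m : ℤ, k + ((n : ℝ) + 1/2) = (m : ℝ)) → |k| ≤ (n : ℝ) + 1/2 →
      |(qnum q (((n : ℝ) + 1/2) - k + 1) * qnum q (((n : ℝ) + 1/2) + k) -
          q ^ 2 * qnum q (((n : ℝ) + 1/2) - k) * qnum q (((n : ℝ) + 1/2) + k + 1)) /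
          qnum q (2 * ((n : ℝ) + 1/2)) - 1 +
        (1 + q ^ 2) * q ^ (2 * ((n : ℝ) + 1/2) + 2 * k)| ≤
        C * q ^ (2 * ((n : ℝ) + 1/2)) := by
  have hq2 : 0 < 1 - q ^ 2 := by nlinarith
  refine ⟨(1 + q ^ 2) / (1 - q ^ 2), by positivity, fun n k _ hk => ?_⟩
  obtain ⟨hk1, hk2⟩ := abs_le.mp hk
  have hn : (0 : ℝ) ≤ n := n.cast_nonneg
  generalize hl : (n : ℝ) + 1 / 2 = l at *
  have hb1 : q ^ (l + k) ≤ 1 := rpow_le_one hq0.le hq1.le (by linarith)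
  have ha0 : 0 < q ^ (l - k) := rpow_pos_of_pos hq0 _
  have hb0 : 0 < q ^ (l + k) := rpow_pos_of_pos hq0 _
  have hT : q ^ (2 * l) = q ^ (l - k) * q ^ (l + k) := by
    rw [← rpow_add hq0]; congr 1; ring
  have hTq : q ^ (2 * l) ≤ q := by
    simpa using rpow_le_rpow_of_exponent_ge hq0 hq1.le (show (1 : ℝ) ≤ 2 * l by linarith)
  have hB : q ^ (2 * l + 2 * k) = (q ^ (l + k)) ^ 2 := by
    rw [pow_two, ← rpow_add hq0]; congr 1; ring
  simp only [qnum, rpow_neg hq0.le, rpow_add_one hq0.ne', hB]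
  rw [hT] at hTq ⊢
  generalize q ^ (l - k) = a at *
  generalize q ^ (l + k) = b at *
  have hab : 0 < a * b := mul_pos ha0 hb0
  have hv : 1 - q ^ 2 ≤ 1 - (a * b) ^ 2 := by gcongr
  have hv0 : 0 < 1 - (a * b) ^ 2 := hq2.trans_le hv
  have hb2 : 0 ≤ 1 - b ^ 2 := by nlinarith
  rw [deviation_eq hq0.ne' hq2.ne' ha0.ne' hb0.ne' hv0.ne', abs_of_nonneg (by positivity),
    div_mul_eq_mul_div]
  have hsq : (a * b) ^ 2 ≤ a * b := by nlinarith
  have hnum : (1 + q ^ 2) * (a * b) ^ 2 * (1 - b ^ 2) ≤ (1 + q ^ 2) * (a * b) :=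
    calc _ ≤ (1 + q ^ 2) * (a * b) ^ 2 :=
          mul_le_of_le_one_right (by positivity) (by nlinarith)
      _ ≤ _ := by gcongr
  exact div_le_div₀ (by positivity) hnum hq2 hv
end
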